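/- arXiv:1707.08896 — 3 statements merged into one kernel-verified Lean document; each statement's English description precedes it below -/
import Mathlib

section
/- Let (A, ∗) be a nonzero finite-dimensional left-symmetric algebra over a field of characteristic zero that is right nilpotent and whose underlying Lie algebra is nilpotent. Then: (i) the subspace triv(A) = {a ∈ A : a∗x = 0 and x∗a = 0 for all x ∈ A} is nonzero; (ii) (A, ∗) is nilpotent, i.e. there exists m ≥ 1 such that every composition T₁ ∘ ⋯ ∘ T_m of m operators, each of which is of the form L(x) or R(x) for some x ∈ A, is the zero operator; (iii) if span{x∗y : x, y ∈ A} ≠ 0, then triv(A) ∩ span{x∗y : x, y ∈ A} ≠ 0. -/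
def IsLSA {𝔽 A : Type*} [Field 𝔽] [AddCommGroup A] [Module 𝔽 A]
    (mul : A →ₗ[𝔽] A →ₗ[𝔽] A) : Prop :=
  ∀ x y z : A,
    mul (mul x y) z - mul x (mul y z) = mul (mul y x) z - mul y (mul x z)

/-- `rightSeries mul i` is 𝔄^{i+1}: 𝔄¹ = A, 𝔄^{i+1} = span{ y∗x : y ∈ 𝔄^i, x ∈ A }. -/
def rightSeries {𝔽 A : Type*} [Field 𝔽] [AddCommGroup A] [Module 𝔽 A]
    (mul : A →ₗ[𝔽] A →ₗ[𝔽] A) : ℕ → Submodule 𝔽 A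
  | 0 => ⊤
  | (i + 1) => Submodule.span 𝔽 {z : A | ∃ y ∈ rightSeries mul i, ∃ x : A, z = mul y x}

/-- `lowerCentral mul i` is A^{i+1}: A¹ = A, A^{i+1} = span{ [x,y] : x ∈ A, y ∈ A^i }. -/
def lowerCentral {𝔽 A : Type*} [Field 𝔽] [AddCommGroup A] [Module 𝔽 A]
    (mul : A →ₗ[𝔽] A →ₗ[𝔽] A) : ℕ → Submodule 𝔽 A
  | 0 => ⊤
  | (i + 1) => Submodule.span 𝔽
      {z : A | ∃ x : A, ∃ y ∈ lowerCentral mul i, z = mul x y - mul y x}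

/-- `T` is a left or a right multiplication operator. -/
def IsMulOp {𝔽 A : Type*} [Field 𝔽] [AddCommGroup A] [Module 𝔽 A]
    (mul : A →ₗ[𝔽] A →ₗ[𝔽] A) (T : A →ₗ[𝔽] A) : Prop :=
  ∃ x : A, T = mul x ∨ T = mul.flip x

section

variable {𝔽 A : Type*} [Field 𝔽] [AddCommGroup A] [Module 𝔽 A] {mul : A →ₗ[𝔽] A →ₗ[𝔽] A}

theorem mul_mem_rightSeries_succ {i : ℕ} {y : A} (hy : y ∈ rightSeries mul i) (x : A) :
    mul y x ∈ rightSeries mul (i + 1) :=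
  Submodule.subset_span ⟨y, hy, x, rfl⟩

theorem rightSeries_succ_le (i : ℕ) : rightSeries mul (i + 1) ≤ rightSeries mul i := by
  induction i with
  | zero => exact le_top
  | succ i ih =>
    refine Submodule.span_le.2 ?_
    rintro _ ⟨y, hy, x, rfl⟩
    exact mul_mem_rightSeries_succ (ih hy) x

theorem mul_mem_rightSeries_right (hlsa : IsLSA mul) {i : ℕ} {y : A}
    (hy : y ∈ rightSeries mul i) (x : A) : mul x y ∈ rightSeries mul i := by
  induction i generalizing x y with
  | zero => exact Submodule.mem_top
  | succ i ih =>
    suffices rightSeries mul (i + 1) ≤ (rightSeries mul (i + 1)).comap (mul x) from this hy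
    refine Submodule.span_le.2 ?_
    rintro _ ⟨y, hy, z, rfl⟩
    have h : mul x (mul y z) = mul (mul x y) z - mul (mul y x) z + mul y (mul x z) := by
      linear_combination (norm := module) -hlsa x y z
    change mul x (mul y z) ∈ rightSeries mul (i + 1)
    rw [h]
    exact add_mem (sub_mem (mul_mem_rightSeries_succ (ih hy x) z)
      (mul_mem_rightSeries_succ (rightSeries_succ_le i (mul_mem_rightSeries_succ hy x)) z))
      (mul_mem_rightSeries_succ hy _)

theorem IsMulOp.apply_mem_rightSeries {T : A →ₗ[𝔽] A} (hT : IsMulOp mul T) (hlsa : IsLSA mul)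
    {i : ℕ} {y : A} (hy : y ∈ rightSeries mul i) : T y ∈ rightSeries mul i := by
  obtain ⟨x, rfl | rfl⟩ := hT
  · exact mul_mem_rightSeries_right hlsa hy x
  · exact rightSeries_succ_le i (mul_mem_rightSeries_succ hy x)

theorem list_prod_apply_mem {l : List (A →ₗ[𝔽] A)} {V : Submodule 𝔽 A}
    (hl : ∀ T ∈ l, ∀ v ∈ V, T v ∈ V) {v : A} (hv : v ∈ V) : l.prod v ∈ V := by
  induction l with
  | nil => exact hv
  | cons T l ih =>
    simp only [List.forall_mem_cons] at hl
    exact hl.1 _ (ih hl.2)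

/-- Modulo `𝔄^{i+2}`, right multiplications kill `𝔄^{i+1}` and left multiplications act on it
as the adjoint representation. -/
theorem list_prod_apply_mem_sup (hlsa : IsLSA mul) {i : ℕ} {v : A}
    (hv : v ∈ rightSeries mul i) {l : List (A →ₗ[𝔽] A)} (hl : ∀ T ∈ l, IsMulOp mul T) :
    l.prod v ∈ rightSeries mul (i + 1) ⊔ lowerCentral mul l.length := by
  induction l with
  | nil => exact Submodule.mem_sup_right Submodule.mem_top
  | cons T l ih =>
    simp only [List.forall_mem_cons] at hl
    have hw : l.prod v ∈ rightSeries mul i :=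
      list_prod_apply_mem (fun T hT _ h => (hl.2 T hT).apply_mem_rightSeries hlsa h) hv
    have hs := ih hl.2
    rw [List.prod_cons, Module.End.mul_apply]
    generalize l.prod v = w at hw hs
    obtain ⟨x, rfl | rfl⟩ := hl.1
    · obtain ⟨a, ha, c, hc, rfl⟩ := Submodule.mem_sup.1 hs
      have h : mul x (a + c) =
          (mul (a + c) x + (mul x a - mul a x)) + (mul x c - mul c x) := by
        simp only [map_add, LinearMap.add_apply]
        abel
      rw [h]
      exact Submodule.add_mem_sup
        (add_mem (mul_mem_rightSeries_succ hw x)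
          (sub_mem (mul_mem_rightSeries_right hlsa ha x)
            (rightSeries_succ_le _ (mul_mem_rightSeries_succ ha x))))
        (Submodule.subset_span ⟨x, c, hc, rfl⟩)
    · exact Submodule.mem_sup_left (mul_mem_rightSeries_succ hw x)

theorem list_prod_apply_mem_rightSeries (hlsa : IsLSA mul) {k : ℕ}
    (hk : lowerCentral mul k = ⊥) (n : ℕ) {l : List (A →ₗ[𝔽] A)}
    (hl : ∀ T ∈ l, IsMulOp mul T) (hlen : l.length = n * k) (v : A) :
    l.prod v ∈ rightSeries mul n := by
  induction n generalizing l with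
  | zero => exact Submodule.mem_top
  | succ n ih =>
    rw [add_mul, one_mul] at hlen
    have hd := ih (l := l.drop k) (fun T hT => hl T (List.mem_of_mem_drop hT))
      (by rw [List.length_drop]; omega)
    have ht := list_prod_apply_mem_sup hlsa hd (l := l.take k)
      (fun T hT => hl T (List.mem_of_mem_take hT))
    rwa [List.length_take, min_eq_left (by omega), hk, sup_bot_eq, ← Module.End.mul_apply,
      List.prod_take_mul_prod_drop] at ht

theorem exists_ne_zero_forall_mul_eq_zero {m : ℕ}
    (hm : ∀ l : List (A →ₗ[𝔽] A), l.length = m → (∀ T ∈ l, IsMulOp mul T) → l.prod = 0)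
    {V : Submodule 𝔽 A} (hV : V ≠ ⊥) (hinv : ∀ T, IsMulOp mul T → ∀ v ∈ V, T v ∈ V) :
    ∃ a : A, a ≠ 0 ∧ a ∈ V ∧ ∀ x : A, mul a x = 0 ∧ mul x a = 0 := by
  by_contra! hcon
  obtain ⟨v, hv, hv0⟩ := V.exists_mem_ne_zero_of_ne_bot hV
  have key (n : ℕ) : ∃ l : List (A →ₗ[𝔽] A), l.length = n ∧ (∀ T ∈ l, IsMulOp mul T) ∧
      l.prod v ≠ 0 := by
    induction n with
    | zero => exact ⟨[], rfl, by simp, hv0⟩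
    | succ n ih =>
      obtain ⟨l, hlen, hl, hne⟩ := ih
      obtain ⟨x, hx⟩ := hcon _ hne (list_prod_apply_mem (fun T hT => hinv T (hl T hT)) hv)
      by_cases h : mul (l.prod v) x = 0
      · exact ⟨mul x :: l, by simp [hlen],
          List.forall_mem_cons.2 ⟨⟨x, Or.inl rfl⟩, hl⟩, hx h⟩
      · exact ⟨mul.flip x :: l, by simp [hlen],
          List.forall_mem_cons.2 ⟨⟨x, Or.inr rfl⟩, hl⟩, h⟩
  obtain ⟨l, hlen, hl, hne⟩ := key m
  exact hne (by rw [hm l hlen hl, LinearMap.zero_apply])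

end

theorem stmt8 (𝔽 : Type*) [Field 𝔽] [CharZero 𝔽]
    (A : Type*) [AddCommGroup A] [Module 𝔽 A] [FiniteDimensional 𝔽 A]
    [Nontrivial A]
    (mul : A →ₗ[𝔽] A →ₗ[𝔽] A) (hlsa : IsLSA mul)
    (hrightnilp : ∃ k : ℕ, rightSeries mul k = ⊥)
    (hlienilp : ∃ k : ℕ, lowerCentral mul k = ⊥) :
    -- (i) triv(A) ≠ 0
    (∃ a : A, a ≠ 0 ∧ ∀ x : A, mul a x = 0 ∧ mul x a = 0) ∧
    -- (ii) (A, ∗) is nilpotent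
    (∃ m : ℕ, 1 ≤ m ∧ ∀ T : Fin m → (A →ₗ[𝔽] A),
      (∀ i : Fin m, ∃ x : A, T i = mul x ∨ T i = mul.flip x) →
      (List.ofFn T).prod = 0) ∧
    -- (iii) if A∗A ≠ 0 then triv(A) meets A∗A nontrivially
    (Submodule.span 𝔽 {z : A | ∃ x y : A, z = mul x y} ≠ ⊥ →
      ∃ a : A, a ≠ 0 ∧ a ∈ Submodule.span 𝔽 {z : A | ∃ x y : A, z = mul x y} ∧
        ∀ x : A, mul a x = 0 ∧ mul x a = 0) := by
  obtain ⟨n, hn⟩ := hrightnilp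
  obtain ⟨k, hk⟩ := hlienilp
  have hnil (l : List (A →ₗ[𝔽] A)) (hlen : l.length = n * k)
      (hl : ∀ T ∈ l, IsMulOp mul T) : l.prod = 0 := by
    ext v
    have h := list_prod_apply_mem_rightSeries hlsa hk n hl hlen v
    rwa [hn, Submodule.mem_bot] at h
  refine ⟨?_, ⟨n * k + 1, by omega, fun T hT => ?_⟩, fun hne => ?_⟩
  · obtain ⟨a, ha, -, h⟩ := exists_ne_zero_forall_mul_eq_zero hnil
      (V := ⊤) top_ne_bot (fun _ _ _ _ => Submodule.mem_top)
    exact ⟨a, ha, h⟩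
  · rw [List.ofFn_succ, List.prod_cons, hnil _ List.length_ofFn, mul_zero]
    rw [List.forall_mem_ofFn_iff]
    exact fun i => hT i.succ
  · refine exists_ne_zero_forall_mul_eq_zero hnil hne ?_
    rintro _ ⟨x, rfl | rfl⟩ v -
    · exact Submodule.subset_span ⟨x, v, rfl⟩
    · exact Submodule.subset_span ⟨v, x, rfl⟩
end

section
/- A finite-dimensional left-symmetric algebra (A, ∗) over a field of characteristic zero is left nil (i.e. L(x) is nilpotent for every x ∈ A) if and only if it is right nil (i.e. R(x) is nilpotent for every x ∈ A) and its underlying Lie algebra is nilpotent. -/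
open Polynomial in
/-- Over a field of characteristic zero, an endomorphism all of whose positive powers are traceless
is nilpotent. -/
theorem Module.End.isNilpotent_of_trace_pow_succ_eq_zero {K V : Type*} [Field K] [CharZero K]
    [AddCommGroup V] [Module K V] [FiniteDimensional K V] {f : Module.End K V}
    (h : ∀ n : ℕ, LinearMap.trace K V (f ^ (n + 1)) = 0) : IsNilpotent f := by
  have trace_aeval : ∀ p : K[X], LinearMap.trace K V (aeval f (p * X)) = 0 := fun p ↦ by
    induction p using Polynomial.induction_on' with
    | add p q hp hq => rw [add_mul, map_add, map_add, hp, hq, add_zero]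
    | monomial n a =>
      rw [monomial_mul_X, aeval_monomial, ← Algebra.smul_def, map_smul, h, smul_zero]
  obtain ⟨q, hq, hXq⟩ := (minpoly K f).exists_eq_pow_rootMultiplicity_mul_and_not_dvd
    (minpoly.ne_zero (Algebra.IsIntegral.isIntegral f)) 0
  rw [C_0, sub_zero] at hq hXq
  set m := (minpoly K f).rootMultiplicity 0
  have hcop : IsCoprime (X ^ (m + 1)) q :=
    ((irreducible_X.coprime_iff_not_dvd).2 hXq).pow_left
  obtain ⟨u, w, huw⟩ := hcop
  have hzero : aeval f (X ^ (m + 1) * q) = 0 := by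
    rw [pow_succ', mul_assoc, ← hq, map_mul, minpoly.aeval, mul_zero]
  have hidem : IsIdempotentElem (aeval f (u * X ^ (m + 1))) := by
    have : u * X ^ (m + 1) * (u * X ^ (m + 1)) =
        u * X ^ (m + 1) - u * w * (X ^ (m + 1) * q) := by
      linear_combination (u * X ^ (m + 1)) * huw
    rw [IsIdempotentElem, ← map_mul, this, map_sub, map_mul _ (u * w), hzero, mul_zero, sub_zero]
  have hu : aeval f (u * X ^ (m + 1)) = 0 :=
    (LinearMap.IsIdempotentElem.trace_eq_zero_iff hidem).1 <| by
      rw [pow_succ, ← mul_assoc]; exact trace_aeval _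
  refine ⟨m + 1, ?_⟩
  have : (X : K[X]) ^ (m + 1) = u * X ^ (m + 1) * X ^ (m + 1) + w * (X ^ (m + 1) * q) := by
    linear_combination (-(X : K[X]) ^ (m + 1)) * huw
  rw [← aeval_X_pow (R := K) f, this, map_add, map_mul, hu, map_mul, hzero, zero_mul, mul_zero,
    add_zero]

namespace IsLSA

variable {𝔽 A : Type*} [Field 𝔽] [AddCommGroup A] [Module 𝔽 A] {mul : A →ₗ[𝔽] A →ₗ[𝔽] A}

theorem mul_commutator (h : IsLSA mul) (x y z : A) :
    mul (mul x y - mul y x) z = mul x (mul y z) - mul y (mul x z) := by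
  rw [map_sub, LinearMap.sub_apply]
  exact sub_eq_sub_iff_sub_eq_sub.1 (h x y z)

/-- The commutator Lie ring of a left-symmetric algebra. -/
abbrev lieRing (h : IsLSA mul) : LieRing A where
  bracket x y := mul x y - mul y x
  add_lie x y z := by simp only [map_add, LinearMap.add_apply]; abel
  lie_add x y z := by simp only [map_add, LinearMap.add_apply]; abel
  lie_self x := sub_self _
  leibniz_lie x y z := by
    change mul x (mul y z - mul z y) - mul (mul y z - mul z y) x =
      mul (mul x y - mul y x) z - mul z (mul x y - mul y x) +
        (mul y (mul x z - mul z x) - mul (mul x z - mul z x) y)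
    rw [h.mul_commutator, h.mul_commutator, h.mul_commutator]
    simp only [map_sub]
    abel

/-- The commutator Lie algebra of a left-symmetric algebra. -/
abbrev lieAlgebra (h : IsLSA mul) : @LieAlgebra 𝔽 A _ h.lieRing :=
  letI := h.lieRing
  { lie_smul := fun t x y ↦ by
      change mul x (t • y) - mul (t • y) x = t • (mul x y - mul y x)
      rw [map_smul, map_smul, LinearMap.smul_apply, smul_sub] }

theorem exists_lowerCentral_eq_bot_iff (h : IsLSA mul) :
    (∃ k, lowerCentral mul k = ⊥) ↔ @LieRing.IsNilpotent A h.lieRing := by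
  let := h.lieRing
  let := h.lieAlgebra
  have key : ∀ k, lowerCentral mul k = (LieModule.lowerCentralSeries 𝔽 A A k).toSubmodule := by
    intro k
    induction k with
    | zero => rfl
    | succ k ih =>
      rw [LieModule.lowerCentralSeries_succ, LieSubmodule.lieIdeal_oper_eq_linear_span',
        lowerCentral, ih]
      congr 1
      ext z
      exact ⟨fun ⟨x, y, hy, hz⟩ ↦ ⟨x, trivial, y, hy, hz.symm⟩,
        fun ⟨x, _, y, hy, hz⟩ ↦ ⟨x, y, hy, hz.symm⟩⟩
  rw [LieRing.IsNilpotent, LieModule.isNilpotent_iff 𝔽]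
  simp only [key, LieSubmodule.toSubmodule_eq_bot]

/-- Left nilpotency of all elements forces every `ad x` to be nilpotent. -/
theorem isNilpotent_sub_flip (h : IsLSA mul) {x : A}
    (hx : IsNilpotent (mul x : Module.End 𝔽 A)) :
    IsNilpotent (mul x - mul.flip x : Module.End 𝔽 A) := by
  have hmul : ∀ (n : ℕ) (y : A), mul (((mul x - mul.flip x : Module.End 𝔽 A) ^ n) y) =
      ((LinearMap.mulLeft 𝔽 (mul x : Module.End 𝔽 A) -
        LinearMap.mulRight 𝔽 (mul x : Module.End 𝔽 A)) ^ n) (mul y) := by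
    intro n y
    induction n with
    | zero => rfl
    | succ n ih =>
      rw [pow_succ', pow_succ', Module.End.mul_apply, Module.End.mul_apply, ← ih]
      ext z
      exact h.mul_commutator _ _ _
  have hker : ∀ (n : ℕ) (z : A), mul z = 0 →
      ((mul x - mul.flip x : Module.End 𝔽 A) ^ n) z = ((mul x : Module.End 𝔽 A) ^ n) z ∧
        mul (((mul x : Module.End 𝔽 A) ^ n) z) = 0 := by
    intro n z hz
    induction n with
    | zero => exact ⟨rfl, hz⟩
    | succ n ih =>
      rw [pow_succ', pow_succ', Module.End.mul_apply, Module.End.mul_apply, ih.1]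
      set w := ((mul x : Module.End 𝔽 A) ^ n) z
      have hw : mul w x = 0 := by rw [ih.2, LinearMap.zero_apply]
      refine ⟨by rw [LinearMap.sub_apply, LinearMap.flip_apply, hw, sub_zero], ?_⟩
      ext y
      have := h.mul_commutator x w y
      rwa [hw, sub_zero, ih.2, LinearMap.zero_apply, LinearMap.zero_apply, map_zero,
        sub_zero] at this
  obtain ⟨m, hm⟩ := hx
  obtain ⟨n, hn⟩ : IsNilpotent (LinearMap.mulLeft 𝔽 (mul x : Module.End 𝔽 A) -
      LinearMap.mulRight 𝔽 (mul x : Module.End 𝔽 A)) := by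
    refine (LinearMap.commute_mulLeft_right (R := 𝔽) _ _).isNilpotent_sub ?_ ?_
    · rw [LinearMap.isNilpotent_mulLeft_iff]; exact ⟨m, hm⟩
    · rw [LinearMap.isNilpotent_mulRight_iff]; exact ⟨m, hm⟩
  refine ⟨m + n, ?_⟩
  ext y
  rw [pow_add, Module.End.mul_apply,
    (hker m _ (by rw [hmul, hn, LinearMap.zero_apply])).1, hm]
  rfl

/-- Traces of powers of a right multiplication are traces of right multiplications. -/
theorem trace_flip_pow_succ (h : IsLSA mul) (v : A) (n : ℕ) :
    LinearMap.trace 𝔽 A ((mul.flip v : Module.End 𝔽 A) ^ (n + 1)) =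
      LinearMap.trace 𝔽 A (mul.flip (((mul.flip v : Module.End 𝔽 A) ^ n) v)) := by
  set R : Module.End 𝔽 A := mul.flip v with hR
  suffices key : ∀ k j : ℕ, LinearMap.trace 𝔽 A (R ^ j * mul.flip ((R ^ k) v)) =
      LinearMap.trace 𝔽 A (R ^ (j + k + 1)) by
    simpa using (key n 0).symm
  intro k
  induction k with
  | zero => intro j; rfl
  | succ k ih =>
    intro j
    set b := (R ^ k) v with hb
    have hmul : (mul.flip ((R ^ (k + 1)) v) : Module.End 𝔽 A) =
        R * mul.flip b + (mul b * R - R * mul b) := by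
      rw [pow_succ', Module.End.mul_apply, ← hb]
      ext y
      have := h b y v
      simp only [hR, LinearMap.flip_apply, LinearMap.add_apply, LinearMap.sub_apply,
        Module.End.mul_apply]
      rw [← sub_eq_zero] at this ⊢
      rw [← this]
      abel
    have hcomm : LinearMap.trace 𝔽 A (R ^ j * (mul b * R - R * mul b)) = 0 := by
      rw [mul_sub, map_sub, ← mul_assoc, LinearMap.trace_mul_comm, ← mul_assoc, ← mul_assoc,
        ← pow_succ', ← pow_succ, sub_self]
    rw [hmul, mul_add, map_add, hcomm, add_zero, ← mul_assoc, ← pow_succ, ih]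
    congr 2
    omega

theorem isNilpotent_flip [CharZero 𝔽] [FiniteDimensional 𝔽 A] (h : IsLSA mul)
    (hL : ∀ x : A, IsNilpotent (mul x : Module.End 𝔽 A)) (x : A) :
    IsNilpotent (mul.flip x : Module.End 𝔽 A) := by
  refine Module.End.isNilpotent_of_trace_pow_succ_eq_zero fun n ↦ ?_
  rw [h.trace_flip_pow_succ]
  generalize ((mul.flip x : Module.End 𝔽 A) ^ n) x = y
  have h₁ := (LinearMap.isNilpotent_trace_of_isNilpotent (hL y)).eq_zero
  have h₂ := (LinearMap.isNilpotent_trace_of_isNilpotent (h.isNilpotent_sub_flip (hL y))).eq_zero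
  rwa [map_sub, h₁, zero_sub, neg_eq_zero] at h₂

end IsLSA

/-- For a module over a nilpotent Lie algebra, an invariant functional attains each of its values
on the zero weight space. -/
theorem LieModule.exists_mem_genWeightSpace_zero_apply_eq {K L M : Type*} [Field K] [LieRing L]
    [LieAlgebra K L] [LieRing.IsNilpotent L] [AddCommGroup M] [Module K M] [LieRingModule L M]
    [LieModule K L M] [FiniteDimensional K M] (φ : M →ₗ[K] K)
    (hφ : ∀ (x : L) (m : M), φ ⁅x, m⁆ = 0) (m : M) :
    ∃ p ∈ LieModule.genWeightSpace M (0 : L → K), φ p = φ m := by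
  have hpos : (LieModule.posFittingComp K L M).toSubmodule ≤ LinearMap.ker φ := by
    rw [LieModule.posFittingComp, LieSubmodule.iSup_toSubmodule, iSup_le_iff]
    intro x q hq
    obtain ⟨r, rfl⟩ := (LieModule.mem_posFittingCompOf K x q).1 hq 1
    simp [hφ]
  have hm : m ∈ LieModule.genWeightSpace M (0 : L → K) ⊔ LieModule.posFittingComp K L M := by
    rw [(LieModule.isCompl_genWeightSpace_zero_posFittingComp K L M).sup_eq_top]
    trivial
  obtain ⟨p, hp, q, hq, rfl⟩ := (LieSubmodule.mem_sup _ _ _).1 hm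
  exact ⟨p, hp, by rw [map_add, LinearMap.mem_ker.1 (hpos hq), add_zero]⟩

namespace IsLSA

variable {𝔽 A : Type*} [Field 𝔽] [AddCommGroup A] [Module 𝔽 A] {mul : A →ₗ[𝔽] A →ₗ[𝔽] A}

/-- The affine action `⁅x, (v, t)⁆ = (x ∗ v + t • x, 0)` of the commutator Lie ring. -/
abbrev affineLieRingModule (h : IsLSA mul) :
    @LieRingModule A (A × 𝔽) h.lieRing _ :=
  letI := h.lieRing
  { bracket := fun x m ↦ (mul x m.1 + m.2 • x, 0)
    add_lie := fun x y m ↦ by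
      ext <;> simp
      abel
    lie_add := fun x m n ↦ by
      ext <;> simp [add_smul]
      abel
    leibniz_lie := fun x y m ↦ by
      refine Prod.ext ?_ (add_zero _).symm
      change mul x (mul y m.1 + m.2 • y) + (0 : 𝔽) • x =
        mul (mul x y - mul y x) m.1 + m.2 • (mul x y - mul y x) +
          (mul y (mul x m.1 + m.2 • x) + (0 : 𝔽) • y)
      rw [h.mul_commutator]
      simp only [map_add, map_smul, zero_smul, smul_sub]
      abel }

theorem affineLieModule (h : IsLSA mul) :
    @LieModule 𝔽 A (A × 𝔽) _ h.lieRing h.lieAlgebra _ _ h.affineLieRingModule :=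
  letI := h.lieRing
  letI := h.lieAlgebra
  letI := h.affineLieRingModule
  { smul_lie := fun t x m ↦ by
      refine Prod.ext ?_ (smul_zero t).symm
      change mul (t • x) m.1 + m.2 • t • x = t • (mul x m.1 + m.2 • x)
      rw [map_smul, LinearMap.smul_apply, smul_add, smul_comm t m.2 x]
    lie_smul := fun t x m ↦ by
      refine Prod.ext ?_ (smul_zero t).symm
      change mul x (t • m.1) + (t * m.2) • x = t • (mul x m.1 + m.2 • x)
      rw [map_smul, smul_add, mul_smul] }

theorem isNilpotent_of_isNilpotent_flip [FiniteDimensional 𝔽 A] (h : IsLSA mul)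
    (hR : ∀ x : A, IsNilpotent (mul.flip x : Module.End 𝔽 A))
    (hA : @LieRing.IsNilpotent A h.lieRing) (x : A) :
    IsNilpotent (mul x : Module.End 𝔽 A) := by
  let := h.lieRing
  let := h.lieAlgebra
  let := h.affineLieRingModule
  have := h.affineLieModule
  have lie_def : ∀ (y : A) (m : A × 𝔽), ⁅y, m⁆ = (mul y m.1 + m.2 • y, 0) := fun _ _ ↦ rfl
  obtain ⟨p, hp, hp1⟩ := LieModule.exists_mem_genWeightSpace_zero_apply_eq (L := A)
    (LinearMap.snd 𝔽 A 𝔽) (fun _ _ ↦ rfl) (0, 1)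
  replace hp1 : p.2 = 1 := hp1
  rw [Module.End.isNilpotent_iff_of_finite]
  intro v
  obtain ⟨y, rfl⟩ : ∃ y, mul y p.1 + y = v := by
    have hu := (hR p.1).isUnit_add_one
    obtain ⟨y, hy⟩ := ((Module.End.isUnit_iff _).1 hu).surjective v
    exact ⟨y, hy⟩
  have hy : ((mul y p.1 + y, 0) : A × 𝔽) ∈ LieModule.genWeightSpace (A × 𝔽) (0 : A → 𝔽) := by
    have := LieSubmodule.lie_mem _ (x := y) hp
    rwa [lie_def, hp1, one_smul] at this
  obtain ⟨k, hk⟩ := (LieModule.mem_genWeightSpace _ _ _).1 hy x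
  have hpow : ∀ (n : ℕ) (w : A), ((LieModule.toEnd 𝔽 A (A × 𝔽) x) ^ n) (w, 0) =
      (((mul x : Module.End 𝔽 A) ^ n) w, 0) := by
    intro n w
    induction n with
    | zero => rfl
    | succ n ih =>
      rw [pow_succ', pow_succ', Module.End.mul_apply, ih, LieModule.toEnd_apply_apply, lie_def,
        zero_smul, add_zero, Module.End.mul_apply]
  rw [Pi.zero_apply, zero_smul, sub_zero, hpow] at hk
  exact ⟨k, congrArg Prod.fst hk⟩

end IsLSA

theorem stmt9 (𝔽 : Type*) [Field 𝔽] [CharZero 𝔽]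
    (A : Type*) [AddCommGroup A] [Module 𝔽 A] [FiniteDimensional 𝔽 A]
    (mul : A →ₗ[𝔽] A →ₗ[𝔽] A) (hlsa : IsLSA mul) :
    (∀ x : A, IsNilpotent (mul x : Module.End 𝔽 A)) ↔
      ((∀ x : A, IsNilpotent (mul.flip x : Module.End 𝔽 A)) ∧
        ∃ k : ℕ, lowerCentral mul k = ⊥) := by
  rw [hlsa.exists_lowerCentral_eq_bot_iff]
  refine ⟨fun hL ↦ ⟨hlsa.isNilpotent_flip hL, ?_⟩,
    fun ⟨hR, hA⟩ ↦ hlsa.isNilpotent_of_isNilpotent_flip hR hA⟩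
  let := hlsa.lieRing
  let := hlsa.lieAlgebra
  exact (LieAlgebra.isNilpotent_iff_forall (R := 𝔽)).2 fun x ↦ hlsa.isNilpotent_sub_flip (hL x)
end

section
/- Let (A, ∗) be a finite-dimensional left-symmetric algebra over a field of characteristic zero. (1) If id_A + R(a) is invertible for every a ∈ A (i.e. (A, ∗) is complete), then the underlying Lie algebra of (A, ∗) is solvable. (2) If A ≠ 0, then the underlying Lie algebra of (A, ∗) is not perfect: span{ x∗y − y∗x : x, y ∈ A } is a proper subspace of A. -/
/-- Derived series of the underlying Lie algebra:
D⁰ = A, D^{i+1} = span{ [x,y] : x, y ∈ D^i }. -/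
def derSeriesLSA {𝔽 A : Type*} [Field 𝔽] [AddCommGroup A] [Module 𝔽 A]
    (mul : A →ₗ[𝔽] A →ₗ[𝔽] A) : ℕ → Submodule 𝔽 A
  | 0 => ⊤
  | (i + 1) => Submodule.span 𝔽
      {z : A | ∃ x ∈ derSeriesLSA mul i, ∃ y ∈ derSeriesLSA mul i,
        z = mul x y - mul y x}

section

universe u
open LieModule LieAlgebra
attribute [local instance] LieRing.ofAssociativeRing

/-- A perfect Lie algebra acts trivially on a module with vanishing trace form. -/
theorem LieModule.lie_eq_zero_of_traceForm_eq_zero {K L M : Type*} [Field K] [CharZero K]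
    [LieRing L] [LieAlgebra K L] [AddCommGroup M] [Module K M] [LieRingModule L M]
    [LieModule K L M] [FiniteDimensional K M]
    (hL : derivedSeries K L 1 = ⊤) (h : traceForm K L M = 0) (x : L) (m : M) : ⁅x, m⁆ = 0 := by
  have h1 := isNilpotent_derivedSeries_of_traceForm_eq_zero h
  have h2 : LieModule.IsNilpotent L M := by
    rw [isNilpotent_iff_forall' (R := K)] at h1 ⊢
    intro x
    exact h1 ⟨x, hL ▸ LieSubmodule.mem_top x⟩
  obtain ⟨k, hk⟩ := (isNilpotent_iff K L M).mp h2
  have hL' : ⁅(⊤ : LieIdeal K L), (⊤ : LieIdeal K L)⁆ = ⊤ := by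
    simpa [derivedSeries_def] using hL
  have key : ∀ n, lowerCentralSeries K L M 1 ≤ lowerCentralSeries K L M (n + 1) := by
    intro n
    induction n with
    | zero => exact le_rfl
    | succ n ih =>
      calc lowerCentralSeries K L M 1 = ⁅(⊤ : LieIdeal K L), (⊤ : LieSubmodule K L M)⁆ := by simp
        _ = ⁅⁅(⊤ : LieIdeal K L), (⊤ : LieIdeal K L)⁆, (⊤ : LieSubmodule K L M)⁆ := by rw [hL']
        _ ≤ ⁅(⊤ : LieIdeal K L), ⁅(⊤ : LieIdeal K L), (⊤ : LieSubmodule K L M)⁆⁆ := by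
          rw [LieSubmodule.lieIdeal_oper_eq_span, LieSubmodule.lieSpan_le]
          rintro _ ⟨⟨a, ha⟩, ⟨m, -⟩, rfl⟩
          change ⁅a, m⁆ ∈ _
          rw [← LieSubmodule.mem_toSubmodule, LieSubmodule.lieIdeal_oper_eq_linear_span'] at ha
          rw [SetLike.mem_coe]
          induction ha using Submodule.span_induction with
          | mem a h =>
            obtain ⟨x, -, y, -, rfl⟩ := h
            rw [lie_lie]
            exact sub_mem (LieSubmodule.lie_mem_lie trivial (LieSubmodule.lie_mem_lie trivial trivial))
              (LieSubmodule.lie_mem_lie trivial (LieSubmodule.lie_mem_lie trivial trivial))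
          | zero => simp
          | add a b _ _ ha hb => rw [add_lie]; exact add_mem ha hb
          | smul t a _ ha => rw [smul_lie]; exact SMulMemClass.smul_mem t ha
        _ ≤ lowerCentralSeries K L M (n + 2) := by
          rw [lowerCentralSeries_succ]
          refine LieSubmodule.mono_lie_right _ (le_trans (le_of_eq ?_) ih)
          simp
  have h3 : ⁅x, m⁆ ∈ lowerCentralSeries K L M (k + 1) := by
    refine key k ?_
    rw [lowerCentralSeries_succ]
    exact LieSubmodule.lie_mem_lie trivial trivial
  have h4 : lowerCentralSeries K L M (k + 1) ≤ lowerCentralSeries K L M k :=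
    antitone_lowerCentralSeries K L M (Nat.le_succ k)
  rw [hk] at h4
  exact (LieSubmodule.mem_bot _).mp (h4 h3)

theorem Module.End.isNilpotent_of_trace_pow_eq_zero {K M : Type*} [Field K] [CharZero K]
    [AddCommGroup M] [Module K M] [FiniteDimensional K M] (f : Module.End K M)
    (h : ∀ k, LinearMap.trace K M (f ^ (k + 1)) = 0) : IsNilpotent f := by
  open Polynomial in
  obtain ⟨g, hg, hg0⟩ := (minpoly K f).exists_eq_pow_rootMultiplicity_mul_and_not_dvd
    (minpoly.ne_zero (Algebra.IsIntegral.isIntegral f)) 0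
  set k := (minpoly K f).rootMultiplicity 0
  rw [map_zero, sub_zero] at hg hg0
  have hco : IsCoprime (X ^ (k + 1)) g := ((irreducible_X.coprime_iff_not_dvd).mpr hg0).pow_left
  obtain ⟨a, b, hab⟩ := hco
  set e : Module.End K M := aeval f (a * X ^ (k + 1)) with he
  have hann : aeval f (g * X ^ (k + 1)) = 0 := by
    have : g * X ^ (k + 1) = minpoly K f * X := by rw [hg]; ring
    rw [this, map_mul, minpoly.aeval, zero_mul]
  have h1e : 1 - e = aeval f (b * g) := by
    rw [← map_one (aeval (R := K) f), ← hab, he, ← map_sub]; congr 1; ring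
  have hidem : IsIdempotentElem e := by
    have : e * (1 - e) = 0 := by
      rw [h1e, he, ← map_mul, show a * X ^ (k + 1) * (b * g) = a * b * (g * X ^ (k + 1)) by ring,
        map_mul, hann, mul_zero]
    rw [mul_sub, mul_one, sub_eq_zero] at this
    exact this.symm
  have htr : LinearMap.trace K M e = 0 := by
    rw [he, aeval_eq_sum_range, map_sum]
    refine Finset.sum_eq_zero fun i _ => ?_
    rw [map_smul, smul_eq_mul]
    rcases i with _ | i
    · simp
    · rw [h, mul_zero]
  have he0 : e = 0 := LinearMap.IsIdempotentElem.eq_zero_of_trace_eq_zero hidem htr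
  refine ⟨k + 1, ?_⟩
  have : aeval f (b * (g * X ^ (k + 1))) = f ^ (k + 1) := by
    rw [← mul_assoc, map_mul, ← h1e, he0]; simp
  rw [← this, map_mul, hann, mul_zero]

theorem LieAlgebra.IsSimple.derivedSeries_one_eq_top (K L : Type*) [Field K] [LieRing L]
    [LieAlgebra K L] [IsSimple K L] : derivedSeries K L 1 = ⊤ := by
  refine (IsSimple.eq_bot_or_eq_top (derivedSeries K L 1)).resolve_left fun h => ?_
  refine IsSimple.non_abelian K (L := L) ⟨fun x y => ?_⟩
  have : ⁅x, y⁆ ∈ derivedSeries K L 1 := by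
    rw [derivedSeries_def, derivedSeriesOfIdeal_succ]
    exact LieSubmodule.lie_mem_lie trivial trivial
  rw [h] at this
  exact (LieSubmodule.mem_bot _).mp this

theorem LieAlgebra.IsSimple.not_isSolvable (K L : Type*) [Field K] [LieRing L]
    [LieAlgebra K L] [IsSimple K L] : ¬ IsSolvable L := by
  intro h
  have : Nontrivial L := by
    by_contra hn
    rw [not_nontrivial_iff_subsingleton] at hn
    exact IsSimple.non_abelian K (L := L) ⟨fun x y => Subsingleton.elim _ _⟩
  exact (derivedSeries_lt_top_of_solvable K L).ne (IsSimple.derivedSeries_one_eq_top K L)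

/-- A Casimir endomorphism of a nontrivial representation of a simple Lie algebra. -/
theorem LieAlgebra.IsSimple.exists_casimir {K S M : Type*} [Field K] [CharZero K]
    [LieRing S] [LieAlgebra K S] [FiniteDimensional K S] [IsSimple K S]
    [AddCommGroup M] [Module K M] [LieRingModule S M]
    [LieModule K S M] [FiniteDimensional K M] (hM : ∃ (x : S) (m : M), ⁅x, m⁆ ≠ 0) :
    ∃ C : Module.End K M, (∀ (x : S) (m : M), C ⁅x, m⁆ = ⁅x, C m⁆) ∧
      (∀ N : Submodule K M, (∀ (x : S) (m : M), ⁅x, m⁆ ∈ N) → ∀ m, C m ∈ N) ∧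
      LinearMap.trace K M C ≠ 0 := by
  set B := traceForm K S M with hB
  have hS := IsSimple.derivedSeries_one_eq_top K S
  have hB0 : B ≠ 0 := fun h => by
    obtain ⟨x, m, hxm⟩ := hM
    exact hxm (LieModule.lie_eq_zero_of_traceForm_eq_zero hS h x m)
  have hinv : B.lieInvariant S := traceForm_lieInvariant K S M
  have hsymm : B.IsSymm := ⟨traceForm_comm K S M⟩
  have hnd : B.Nondegenerate := by
    rcases IsSimple.eq_bot_or_eq_top
      (InvariantForm.orthogonal B hinv (⊤ : LieIdeal K S)) with h | h
    · rw [LieSubmodule.eq_bot_iff] at h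
      refine ⟨fun x hx => h x ?_, fun x hx => h x ?_⟩
      · rw [InvariantForm.mem_orthogonal]
        exact fun y _ => by rw [hB, traceForm_comm]; exact hx y
      · rw [InvariantForm.mem_orthogonal]
        exact fun y _ => hx y
    · refine absurd ?_ hB0
      ext x y
      have : y ∈ InvariantForm.orthogonal B hinv (⊤ : LieIdeal K S) := by
        rw [h]
        exact LieSubmodule.mem_top y
      rw [InvariantForm.mem_orthogonal] at this
      exact this x trivial
  classical
  set b := Module.finBasis K S
  set b' := B.dualBasis hnd b with hb'
  have e1 : ∀ y, y = ∑ j, B (b' j) y • b j := fun y => by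
    conv_lhs => rw [← b.sum_repr y]
    refine Finset.sum_congr rfl fun j _ => ?_
    congr 1
    have hbb : B.dualBasis hnd b' = b := LinearMap.BilinForm.dualBasis_dualBasis hnd hsymm b
    rw [← hbb, LinearMap.BilinForm.dualBasis_repr_apply, hB, traceForm_comm]
  have e2 : ∀ y, y = ∑ j, B y (b j) • b' j := fun y => by
    conv_lhs => rw [← b'.sum_repr y]
    simp [hb']
  refine ⟨∑ i, toEnd K S M (b i) * toEnd K S M (b' i), fun x m => ?_, fun N hN m => ?_, ?_⟩
  · rw [← sub_eq_zero, ← neg_eq_zero, neg_sub]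
    have h1 : ∑ i, ⁅⁅x, b i⁆, ⁅b' i, m⁆⁆ = ∑ i, ∑ j, B (b' j) ⁅x, b i⁆ • ⁅b j, ⁅b' i, m⁆⁆ := by
      refine Finset.sum_congr rfl fun i _ => ?_
      conv_lhs => rw [e1 ⁅x, b i⁆]
      simp [sum_lie]
    have h2 : ∑ i, ⁅b i, ⁅⁅x, b' i⁆, m⁆⁆ = ∑ i, ∑ j, B ⁅x, b' i⁆ (b j) • ⁅b i, ⁅b' j, m⁆⁆ := by
      refine Finset.sum_congr rfl fun i _ => ?_
      conv_lhs => rw [e2 ⁅x, b' i⁆]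
      simp [sum_lie, lie_sum]
    have h3 : ∑ i, ⁅⁅x, b i⁆, ⁅b' i, m⁆⁆ + ∑ i, ⁅b i, ⁅⁅x, b' i⁆, m⁆⁆ = 0 := by
      rw [h1, h2, Finset.sum_comm, ← Finset.sum_add_distrib]
      refine Finset.sum_eq_zero fun i _ => ?_
      rw [← Finset.sum_add_distrib]
      refine Finset.sum_eq_zero fun j _ => ?_
      rw [hinv x (b' i) (b j), neg_smul, add_neg_cancel]
    rw [← h3]
    simp only [LinearMap.sum_apply, Module.End.mul_apply, toEnd_apply_apply, lie_sum,
      ← Finset.sum_sub_distrib, ← Finset.sum_add_distrib]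
    refine Finset.sum_congr rfl fun i _ => ?_
    simp only [lie_lie, lie_sub]
    abel
  · simp only [LinearMap.sum_apply, Module.End.mul_apply, toEnd_apply_apply]
    exact sum_mem fun i _ => hN _ _
  · have : ∀ i, LinearMap.trace K M (toEnd K S M (b i) * toEnd K S M (b' i)) = 1 := fun i => by
      have := LinearMap.BilinForm.apply_dualBasis_right hnd hsymm b i i
      rw [if_pos rfl] at this
      exact this
    rw [map_sum]
    simp only [this]
    have : Nontrivial S := by
      obtain ⟨x, m, hxm⟩ := hM
      exact ⟨x, 0, fun h => hxm (by rw [h, zero_lie])⟩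
    simpa using (Module.finrank_pos (R := K) (M := S)).ne'

/-- If a simple Lie algebra maps a module into a proper subspace `N`, it has an invariant
outside `N`. -/
theorem LieAlgebra.IsSimple.exists_invariant_notMem {K S : Type*} [Field K] [CharZero K]
    [LieRing S] [LieAlgebra K S] [FiniteDimensional K S] [IsSimple K S]
    {M : Type*} [AddCommGroup M] [Module K M] [LieRingModule S M]
    [LieModule K S M] [FiniteDimensional K M] (N : Submodule K M) (hN : N ≠ ⊤)
    (hSN : ∀ (x : S) (m : M), ⁅x, m⁆ ∈ N) : ∃ m, m ∉ N ∧ ∀ x : S, ⁅x, m⁆ = 0 := by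
  induction hn : Module.finrank K M using Nat.strong_induction_on generalizing M with
  | _ n ih =>
  by_cases hM : ∃ (x : S) (m : M), ⁅x, m⁆ ≠ 0
  · obtain ⟨C, hC, hCN, htr⟩ := IsSimple.exists_casimir (K := K) hM
    obtain ⟨k, hk, hk1⟩ := (C.eventually_isCompl_ker_pow_range_pow.and
      (Filter.eventually_ge_atTop 1)).exists
    let P : LieSubmodule K S M :=
      { LinearMap.ker (C ^ k) with
        lie_mem := by
          intro x m (hm : (C ^ k) m = 0)
          change (C ^ k) ⁅x, m⁆ = 0
          have : ∀ (j : ℕ) (m : M), (C ^ j) ⁅x, m⁆ = ⁅x, (C ^ j) m⁆ := fun j => by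
            induction j with
            | zero => simp
            | succ j ihj => intro m; rw [pow_succ, Module.End.mul_apply, hC, ihj]; rfl
          rw [this, hm, lie_zero] }
    have hP : P.toSubmodule = LinearMap.ker (C ^ k) := rfl
    have hrange : LinearMap.range (C ^ k) ≤ N := by
      rintro _ ⟨m, rfl⟩
      obtain ⟨j, rfl⟩ : ∃ j, k = j + 1 := ⟨k - 1, by omega⟩
      rw [pow_succ', Module.End.mul_apply]
      exact hCN N hSN _
    have hPN : ¬ P.toSubmodule ≤ N := fun h => hN <| top_le_iff.mp <|
      hk.sup_eq_top ▸ sup_le h hrange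
    have hPtop : P.toSubmodule ≠ ⊤ := fun h => htr <| by
      have : IsNilpotent C := ⟨k, LinearMap.ker_eq_top.mp h⟩
      exact (LinearMap.isNilpotent_trace_of_isNilpotent this).eq_zero
    obtain ⟨m, hm, hx⟩ := ih (Module.finrank K P)
      (hn ▸ Submodule.finrank_lt hPtop) (M := P)
      (N.comap P.toSubmodule.subtype)
      (fun h => hPN <| Submodule.comap_subtype_eq_top.mp h)
      (fun x m => hSN x m) rfl
    exact ⟨m, hm, fun x => by simpa using congrArg Subtype.val (hx x)⟩
  · push Not at hM
    obtain ⟨m, -, hm⟩ := SetLike.exists_of_lt (lt_top_iff_ne_top.mpr hN)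
    exact ⟨m, hm, fun x => hM x m⟩

/-- The `L`-module of endomorphisms of `L` with values in an ideal `V`, acting on `V` by a
scalar. -/
def LieIdeal.scalarEnd {K L : Type*} [Field K] [LieRing L] [LieAlgebra K L] (V : LieIdeal K L) :
    LieSubmodule K L (L →ₗ[K] L) where
  carrier := {φ | (∀ x, φ x ∈ V) ∧ ∃ c : K, ∀ v ∈ V, φ v = c • v}
  add_mem' := by
    rintro φ ψ ⟨hφ, c, hc⟩ ⟨hψ, d, hd⟩
    exact ⟨fun x => add_mem (hφ x) (hψ x), c + d, fun v hv => by
      rw [LinearMap.add_apply, hc v hv, hd v hv, add_smul]⟩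
  zero_mem' := ⟨fun x => zero_mem V, 0, fun v _ => by simp⟩
  smul_mem' := by
    rintro t φ ⟨hφ, c, hc⟩
    exact ⟨fun x => SMulMemClass.smul_mem t (hφ x), t * c, fun v hv => by
      rw [LinearMap.smul_apply, hc v hv, mul_smul]⟩
  lie_mem := by
    rintro x φ ⟨hφ, c, hc⟩
    refine ⟨fun y => ?_, 0, fun v hv => ?_⟩
    · rw [LieHom.lie_apply]
      exact sub_mem (lie_mem_right K L V _ _ (hφ y)) (hφ _)
    · rw [LieHom.lie_apply, hc v hv, hc _ (lie_mem_right K L V _ _ hv)]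
      simp

/-- The submodule of `V.scalarEnd` consisting of the `ad v` with `v ∈ V`. -/
def LieIdeal.adScalarEnd {K L : Type*} [Field K] [LieRing L] [LieAlgebra K L] (V : LieIdeal K L) :
    LieSubmodule K L V.scalarEnd where
  carrier := {φ | ∃ v ∈ V, (φ : L →ₗ[K] L) = ad K L v}
  add_mem' := by
    rintro φ ψ ⟨v, hv, hφ⟩ ⟨w, hw, hψ⟩
    exact ⟨v + w, add_mem hv hw, by simp [hφ, hψ]⟩
  zero_mem' := ⟨0, zero_mem V, by simp⟩
  smul_mem' := by
    rintro t φ ⟨v, hv, hφ⟩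
    exact ⟨t • v, SMulMemClass.smul_mem t hv, by simp [hφ]⟩
  lie_mem := by
    rintro x φ ⟨v, hv, hφ⟩
    refine ⟨⁅x, v⁆, lie_mem_right K L V _ _ hv, ?_⟩
    ext y
    simp [hφ, LieHom.lie_apply]

/-- The action of `L ⧸ V` on an `L`-module on which `V` acts trivially. -/
def LieIdeal.quotientToEnd {K L M : Type*} [Field K] [LieRing L] [LieAlgebra K L] [AddCommGroup M]
    [Module K M] [LieRingModule L M] [LieModule K L M] (V : LieIdeal K L)
    (h : ∀ v ∈ V, ∀ m : M, ⁅v, m⁆ = 0) : (L ⧸ V) →ₗ⁅K⁆ Module.End K M where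
  toLinearMap := V.toSubmodule.liftQ (toEnd K L M : L →ₗ[K] Module.End K M)
    fun v hv => LinearMap.ext fun m => h v hv m
  map_lie' := by
    intro x y
    obtain ⟨x, rfl⟩ := LieSubmodule.Quotient.surjective_mk' V x
    obtain ⟨y, rfl⟩ := LieSubmodule.Quotient.surjective_mk' V y
    exact LieHom.map_lie (toEnd K L M) x y

/-- A perfect extension of a simple Lie algebra by a nonzero abelian ideal `V` is the sum of `V` and
a proper subalgebra. -/
theorem LieIdeal.exists_subalgebra_supplement {K L S : Type*} [Field K] [CharZero K]
    [LieRing L] [LieAlgebra K L] [FiniteDimensional K L]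
    [LieRing S] [LieAlgebra K S] [FiniteDimensional K S] [IsSimple K S]
    (hL : derivedSeries K L 1 = ⊤) (V : LieIdeal K L) (hV : IsLieAbelian V) (hV0 : V ≠ ⊥)
    (f : S →ₗ⁅K⁆ L ⧸ V) (hf : Function.Surjective f) :
    ∃ q : LieSubalgebra K L, q ≠ ⊤ ∧ ∀ x, ∃ v ∈ V, x + v ∈ q := by
  have hVV : ∀ v ∈ V, ∀ w ∈ V, ⁅v, w⁆ = 0 := fun v hv w hw => by
    simpa using congrArg Subtype.val (hV.trivial ⟨v, hv⟩ ⟨w, hw⟩)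
  have hact : ∀ v ∈ V, ∀ c : K, ∀ φ : L →ₗ[K] L, (∀ x, φ x ∈ V) → (∀ v ∈ V, φ v = c • v) →
      ⁅v, φ⁆ = -(c • ad K L v) := by
    intro v hv c φ hφ hc
    ext y
    rw [LieHom.lie_apply, hVV v hv _ (hφ y), hc _ (lie_mem_left K L V _ _ hv)]
    simp
  let Q := V.scalarEnd ⧸ V.adScalarEnd
  have hQ : ∀ v ∈ V, ∀ m : Q, ⁅v, m⁆ = 0 := by
    intro v hv m
    obtain ⟨φ, rfl⟩ := LieSubmodule.Quotient.surjective_mk' _ m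
    rw [← LieModuleHom.map_lie, LieSubmodule.Quotient.mk_eq_zero]
    obtain ⟨hφ, c, hc⟩ := φ.2
    refine ⟨-(c • v), neg_mem (SMulMemClass.smul_mem c hv), ?_⟩
    rw [LieSubmodule.coe_bracket, hact v hv c φ hφ hc]
    simp
  let g : S →ₗ⁅K⁆ Module.End K Q := (V.quotientToEnd hQ).comp f
  let _ : LieRingModule S Q := LieRingModule.compLieHom Q g
  have _ : LieModule K S Q := LieModule.compLieHom Q g
  have hg : ∀ (s : S) (x : L) (m : Q), f s = LieSubmodule.Quotient.mk x → ⁅s, m⁆ = ⁅x, m⁆ := by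
    intro s x m h
    change V.quotientToEnd hQ (f s) m = _
    rw [h]
    rfl
  let N' : Submodule K V.scalarEnd :=
    { carrier := {φ | ∀ v ∈ V, (φ : L →ₗ[K] L) v = 0}
      add_mem' := fun {φ ψ} hφ hψ v hv => by simp [hφ v hv, hψ v hv]
      zero_mem' := fun v _ => by simp
      smul_mem' := fun t φ hφ v hv => by simp [hφ v hv] }
  have hN' : ∀ φ ∈ V.adScalarEnd, φ ∈ N' := by
    rintro φ ⟨v, hv, hφ⟩ w hw
    rw [hφ]
    exact hVV v hv w hw
  let π : V.scalarEnd →ₗ[K] Q := (LieSubmodule.Quotient.mk' V.adScalarEnd : V.scalarEnd →ₗ[K] Q)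
  have hπ : ∀ φ, π φ ∈ N'.map π → φ ∈ N' := by
    rintro φ ⟨ψ, hψ, h⟩
    rw [eq_comm, ← sub_eq_zero, ← map_sub] at h
    have := hN' _ ((LieSubmodule.Quotient.mk_eq_zero _).mp h)
    simpa using add_mem this hψ
  obtain ⟨v₀, hv₀, hv₀'⟩ : ∃ v ∈ V, v ≠ 0 := by
    by_contra! h
    exact hV0 (V.eq_bot_iff.mpr h)
  have hN : N'.map π ≠ ⊤ := by
    intro h
    obtain ⟨r, hr⟩ := V.toSubmodule.subtype.exists_leftInverse_of_injective
      (LinearMap.ker_eq_bot.mpr V.toSubmodule.injective_subtype)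
    have hr' : ∀ v (hv : v ∈ V), r v = (⟨v, hv⟩ : V.toSubmodule) := fun v hv =>
      LinearMap.congr_fun hr (⟨v, hv⟩ : V.toSubmodule)
    let φ : V.scalarEnd := ⟨V.toSubmodule.subtype ∘ₗ r, fun x => (r x).2, 1, fun v hv => by
      simp [hr' v hv]⟩
    have := hπ φ (h ▸ Submodule.mem_top) v₀ hv₀
    simp [φ, hr' v₀ hv₀, hv₀'] at this
  obtain ⟨m, hm, hSm⟩ := IsSimple.exists_invariant_notMem (S := S) (N'.map π) hN (by
    intro s m
    obtain ⟨x, hx⟩ := LieSubmodule.Quotient.surjective_mk' V (f s)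
    obtain ⟨φ, rfl⟩ := LieSubmodule.Quotient.surjective_mk' _ m
    rw [hg s x _ hx.symm, ← LieModuleHom.map_lie]
    refine Submodule.mem_map_of_mem fun v hv => ?_
    obtain ⟨hφ, c, hc⟩ := φ.2
    rw [LieSubmodule.coe_bracket, LieHom.lie_apply, hc v hv, hc _ (lie_mem_right K L V _ _ hv)]
    simp)
  obtain ⟨φ, rfl⟩ := LieSubmodule.Quotient.surjective_mk' _ m
  obtain ⟨hφ, c, hc⟩ := φ.2
  have hc0 : c ≠ 0 := by
    rintro rfl
    exact hm (Submodule.mem_map_of_mem (f := π) fun v hv => by rw [hc v hv, zero_smul])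
  have hφx : ∀ x : L, ∃ v ∈ V, ⁅x, (φ : L →ₗ[K] L)⁆ = ad K L v := by
    intro x
    obtain ⟨s, hs⟩ := hf (LieSubmodule.Quotient.mk x)
    have := hSm s
    rw [hg s x _ hs, ← LieModuleHom.map_lie, LieSubmodule.Quotient.mk_eq_zero] at this
    exact this
  let q : LieSubalgebra K L :=
    { carrier := {x | ⁅x, (φ : L →ₗ[K] L)⁆ = 0}
      add_mem' := fun {x y} hx hy => by
        change ⁅x + y, (φ : L →ₗ[K] L)⁆ = 0
        rw [add_lie, hx, hy, add_zero]
      zero_mem' := zero_lie _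
      smul_mem' := fun t x hx => by
        change ⁅t • x, (φ : L →ₗ[K] L)⁆ = 0
        rw [smul_lie, hx, smul_zero]
      lie_mem' := fun {x y} hx hy => by
        change ⁅⁅x, y⁆, (φ : L →ₗ[K] L)⁆ = 0
        rw [lie_lie, hx, hy, lie_zero, lie_zero, sub_zero] }
  refine ⟨q, fun hq => ?_, fun x => ?_⟩
  · have hqx : ∀ x : L, ⁅x, (φ : L →ₗ[K] L)⁆ = 0 := fun x => by
      have : x ∈ q := hq ▸ LieSubalgebra.mem_top x
      exact this
    have hcen : ∀ v ∈ V, ∀ y : L, ⁅v, y⁆ = 0 := by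
      intro v hv y
      have := LinearMap.congr_fun ((hqx v).symm.trans (hact v hv c φ hφ hc)) y
      simpa [hc0] using this
    have hker : ∀ x ∈ derivedSeries K L 1, (φ : L →ₗ[K] L) x = 0 := by
      intro x hx
      rw [derivedSeries_def, derivedSeriesOfIdeal_succ, ← LieSubmodule.mem_toSubmodule,
        LieSubmodule.lieIdeal_oper_eq_linear_span'] at hx
      induction hx using Submodule.span_induction with
      | mem a h =>
        obtain ⟨x, -, y, -, rfl⟩ := h
        have := LinearMap.congr_fun (hqx x) y
        rw [LieHom.lie_apply, ← lie_skew, hcen _ (hφ y)] at this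
        simpa using this
      | zero => simp
      | add a b _ _ ha hb => rw [map_add, ha, hb, add_zero]
      | smul t a _ ha => rw [map_smul, ha, smul_zero]
    have := hker v₀ (hL ▸ LieSubmodule.mem_top v₀)
    rw [hc v₀ hv₀, smul_eq_zero] at this
    exact this.elim hc0 hv₀'
  · obtain ⟨v, hv, hxv⟩ := hφx x
    refine ⟨c⁻¹ • v, SMulMemClass.smul_mem _ hv, ?_⟩
    change ⁅x + c⁻¹ • v, (φ : L →ₗ[K] L)⁆ = 0
    rw [add_lie, smul_lie, hxv, hact v hv c φ hφ hc, smul_neg, inv_smul_smul₀ hc0, add_neg_cancel]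

theorem LieAlgebra.isSolvable_of_quotient {K L : Type*} [Field K] [LieRing L] [LieAlgebra K L]
    (V : LieIdeal K L) (hV : IsLieAbelian V) (h : IsSolvable (L ⧸ V)) : IsSolvable L := by
  obtain ⟨k, hk⟩ := (isSolvable_iff K (L ⧸ V)).mp h
  let π : L →ₗ⁅K⁆ L ⧸ V :=
    { (LieSubmodule.Quotient.mk' V : L →ₗ[K] L ⧸ V) with map_lie' := fun {x y} => rfl }
  have hle : derivedSeries K L k ≤ V := fun x hx => by
    have := LieIdeal.mem_map (f := π) hx
    rw [LieIdeal.derivedSeries_map_eq k (LieSubmodule.Quotient.surjective_mk' V), hk] at this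
    exact (LieSubmodule.Quotient.mk_eq_zero V).mp this
  refine IsSolvable.mk (R := K) (k := k + 1) (eq_bot_iff.mpr ?_)
  rw [derivedSeries_def, derivedSeriesOfIdeal_succ,
    ← (LieSubmodule.lie_abelian_iff_lie_self_eq_bot V).mp hV]
  exact LieSubmodule.mono_lie hle hle

/-- A non-solvable Lie algebra in characteristic zero contains a simple subalgebra. -/
theorem LieAlgebra.exists_isSimple_injective {K : Type*} {L : Type u} [Field K] [CharZero K]
    [LieRing L] [LieAlgebra K L] [FiniteDimensional K L] (hL : ¬ IsSolvable L) :
    ∃ (S : Type u) (_ : LieRing S) (_ : LieAlgebra K S) (f : S →ₗ⁅K⁆ L),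
      IsSimple K S ∧ Function.Injective f := by
  induction hn : Module.finrank K L using Nat.strong_induction_on generalizing L with
  | _ n ih =>
  subst hn
  by_cases hsub : ∃ q : LieSubalgebra K L, q ≠ ⊤ ∧ ¬ IsSolvable q
  · obtain ⟨q, hq, hqs⟩ := hsub
    have hlt : Module.finrank K q < Module.finrank K L :=
      Submodule.finrank_lt (s := q.toSubmodule) fun h => hq (by
        rw [← LieSubalgebra.toSubmodule_inj, h]; rfl)
    obtain ⟨S, _, _, f, hS, hf⟩ := ih _ hlt hqs rfl
    exact ⟨S, _, _, q.incl.comp f, hS, Subtype.val_injective.comp hf⟩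
  push Not at hsub
  have hideal : ∀ I : LieIdeal K L, I ≠ ⊤ → IsSolvable I := fun I hI =>
    hsub (I.toLieSubalgebra K L) fun h => hI <| by
      rw [← LieSubmodule.toSubmodule_inj]
      exact congrArg LieSubalgebra.toSubmodule h
  by_cases hab : ∃ V : LieIdeal K L, IsLieAbelian V ∧ V ≠ ⊥
  · obtain ⟨V, hV, hV0⟩ := hab
    have hder : derivedSeries K L 1 = ⊤ := by
      by_contra h
      obtain ⟨k, hk⟩ := (isSolvable_iff K _).mp (hideal _ h)
      refine hL (IsSolvable.mk (R := K) (k := k + 1) ?_)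
      rw [LieIdeal.derivedSeries_eq_bot_iff, derivedSeries_def, ← derivedSeriesOfIdeal_add] at hk
      exact hk
    have hlt : Module.finrank K (L ⧸ V) < Module.finrank K L := by
      have h := Submodule.finrank_quotient_add_finrank V.toSubmodule
      have h' : 0 < Module.finrank K V.toSubmodule := by
        rw [Nat.pos_iff_ne_zero, Ne, Submodule.finrank_eq_zero]
        simpa using hV0
      change Module.finrank K (L ⧸ V.toSubmodule) < _
      omega
    obtain ⟨S, _, _, f, hS, hf⟩ := ih _ hlt
      (fun h => hL (isSolvable_of_quotient V hV h)) rfl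
    have : FiniteDimensional K S := Module.Finite.of_injective (f : S →ₗ[K] L ⧸ V) hf
    let π : L →ₗ⁅K⁆ L ⧸ V :=
      { (LieSubmodule.Quotient.mk' V : L →ₗ[K] L ⧸ V) with map_lie' := fun {x y} => rfl }
    have hcover : ∀ q : LieSubalgebra K L, (∀ s, ∃ x ∈ q, π x = f s) → q = ⊤ := by
      intro q hq
      by_contra hne
      have := hsub q hne
      have hr : IsSolvable (π.comp q.incl).range := inferInstance
      have hle : f.range ≤ (π.comp q.incl).range := by
        rintro _ ⟨s, rfl⟩
        obtain ⟨x, hx, h⟩ := hq s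
        exact ⟨⟨x, hx⟩, h⟩
      have h1 : IsSolvable f.range :=
        (LieSubalgebra.inclusion_injective hle).lieAlgebra_isSolvable
      exact IsSimple.not_isSolvable K S
        ((LieEquiv.ofInjective f hf).injective.lieAlgebra_isSolvable)
    have hsurj : Function.Surjective f := by
      have := hcover (f.range.comap π) fun s => by
        obtain ⟨x, hx⟩ := LieSubmodule.Quotient.surjective_mk' V (f s)
        exact ⟨x, ⟨s, hx.symm⟩, hx⟩
      intro y
      obtain ⟨x, rfl⟩ := LieSubmodule.Quotient.surjective_mk' V y
      have hx : x ∈ f.range.comap π := this ▸ LieSubalgebra.mem_top x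
      exact hx
    obtain ⟨q, hq, hqV⟩ := V.exists_subalgebra_supplement hder hV hV0 f hsurj
    refine absurd (hcover q fun s => ?_) hq
    obtain ⟨x, hx⟩ := LieSubmodule.Quotient.surjective_mk' V (f s)
    obtain ⟨v, hv, hxv⟩ := hqV x
    refine ⟨x + v, hxv, ?_⟩
    have : π v = 0 := (LieSubmodule.Quotient.mk_eq_zero _).mpr hv
    rw [map_add, this, add_zero]
    exact hx
  · push Not at hab
    have := (hasTrivialRadical_iff_no_abelian_ideals K L).mpr hab
    refine ⟨L, _, _, LieHom.id, ⟨fun I => ?_, fun h => hL inferInstance⟩, fun _ _ h => h⟩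
    by_cases hI : I = ⊤
    · exact Or.inr hI
    · have := hideal I hI
      exact Or.inl (HasTrivialRadical.eq_bot_of_isSolvable I)

/-- The Lie ring structure with bracket `x ∗ y - y ∗ x` of a left-symmetric algebra. -/
abbrev IsLSA.lieRing_s10 {K A : Type*} [Field K] [AddCommGroup A] [Module K A]
    {mul : A →ₗ[K] A →ₗ[K] A} (h : IsLSA mul) : LieRing A where
  bracket x y := mul x y - mul y x
  add_lie x y z := by simp only [map_add, LinearMap.add_apply]; abel
  lie_add x y z := by simp only [map_add, LinearMap.add_apply]; abel
  lie_self x := sub_self _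
  leibniz_lie x y z := by
    have h₁ := h x y z
    have h₂ := h y z x
    have h₃ := h z x y
    simp only [map_sub, LinearMap.sub_apply]
    linear_combination (norm := module) -h₁ - h₂ - h₃

/-- The Lie algebra structure with bracket `x ∗ y - y ∗ x` of a left-symmetric algebra. -/
abbrev IsLSA.lieAlgebra_s10 {K A : Type*} [Field K] [AddCommGroup A] [Module K A]
    {mul : A →ₗ[K] A →ₗ[K] A} (h : IsLSA mul) : letI := h.lieRing_s10; LieAlgebra K A :=
  letI := h.lieRing_s10
  { lie_smul := fun t x y => by
      change mul x (t • y) - mul (t • y) x = t • (mul x y - mul y x)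
      simp [smul_sub] }

theorem IsLSA.derSeriesLSA_eq {K A : Type*} [Field K] [AddCommGroup A] [Module K A]
    {mul : A →ₗ[K] A →ₗ[K] A} (h : IsLSA mul) (k : ℕ) :
    letI := h.lieRing_s10
    letI := h.lieAlgebra_s10
    derSeriesLSA mul k = (derivedSeries K A k).toSubmodule := by
  let _ := h.lieRing_s10
  let _ := h.lieAlgebra_s10
  induction k with
  | zero => rfl
  | succ k ih =>
    rw [derivedSeries_def, derivedSeriesOfIdeal_succ, LieSubmodule.lieIdeal_oper_eq_linear_span',
      derSeriesLSA, ih]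
    congr 1
    ext z
    exact exists_congr fun x => and_congr_right fun _ => exists_congr fun y =>
      and_congr_right fun _ => eq_comm

/-- The affine action of a left-symmetric algebra on itself, extended linearly to `A × K`. -/
def IsLSA.affineRep {K A : Type*} [Field K] [AddCommGroup A] [Module K A]
    {mul : A →ₗ[K] A →ₗ[K] A} (h : IsLSA mul) :
    letI := h.lieRing_s10
    letI := h.lieAlgebra_s10
    A →ₗ⁅K⁆ Module.End K (A × K) :=
  letI := h.lieRing_s10
  letI := h.lieAlgebra_s10
  { toFun := fun x => LinearMap.inl K A K ∘ₗ (mul x).coprod (LinearMap.toSpanSingleton K A x)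
    map_add' := fun x y => by ext <;> simp
    map_smul' := fun t x => by ext <;> simp
    map_lie' := fun {x y} => by
      have hxy : ⁅x, y⁆ = mul x y - mul y x := rfl
      ext z
      · have := h x y z
        simp [LieRing.of_associative_ring_bracket, hxy]
        linear_combination (norm := module) this
      · simp
      · simp [LieRing.of_associative_ring_bracket, hxy]
      · simp }

/-- The underlying Lie algebra of a complete left-symmetric algebra is solvable. -/
theorem IsLSA.exists_derSeriesLSA_eq_bot {K A : Type*} [Field K] [CharZero K] [AddCommGroup A]
    [Module K A] [FiniteDimensional K A] {mul : A →ₗ[K] A →ₗ[K] A} (h : IsLSA mul)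
    (hc : ∀ a, Function.Injective (LinearMap.id + mul.flip a : A →ₗ[K] A)) :
    ∃ k, derSeriesLSA mul k = ⊥ := by
  let _ := h.lieRing_s10
  let _ := h.lieAlgebra_s10
  by_cases hs : IsSolvable A
  · obtain ⟨k, hk⟩ := (isSolvable_iff K A).mp hs
    exact ⟨k, by rw [h.derSeriesLSA_eq k, hk]; rfl⟩
  exfalso
  obtain ⟨S, _, _, f, hS, hf⟩ := exists_isSimple_injective (K := K) hs
  have : FiniteDimensional K S := Module.Finite.of_injective (f : S →ₗ[K] A) hf
  let g := h.affineRep.comp f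
  let _ : LieRingModule S (A × K) := LieRingModule.compLieHom _ g
  have _ : LieModule K S (A × K) := LieModule.compLieHom _ g
  have hg : ∀ (s : S) (p : A × K), ⁅s, p⁆ = (mul (f s) p.1 + p.2 • f s, 0) := fun _ _ => rfl
  obtain ⟨⟨a, c⟩, hac, hinv⟩ := IsSimple.exists_invariant_notMem (K := K) (S := S)
    (LinearMap.ker (LinearMap.snd K A K))
    (fun hker => by
      have : ((0, 1) : A × K) ∈ LinearMap.ker (LinearMap.snd K A K) := hker ▸ Submodule.mem_top
      simp at this)
    fun s p => by simp [hg]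
  have hc0 : c ≠ 0 := by simpa using hac
  refine IsSimple.not_isSolvable K S ?_
  have h0 : ∀ s : S, s = 0 := fun s => hf <| by
    rw [map_zero]
    refine hc (c⁻¹ • a) ?_
    have := congrArg Prod.fst (hinv s)
    rw [hg] at this
    simp only [Prod.fst_zero] at this
    rw [map_zero, LinearMap.add_apply, LinearMap.id_apply, LinearMap.flip_apply, map_smul]
    rw [← smul_right_injective A hc0 |>.eq_iff]
    simpa [smul_smul, hc0, add_comm] using this
  have : Subsingleton S := ⟨fun s t => (h0 s).trans (h0 t).symm⟩
  have : IsLieAbelian S := ⟨fun s t => Subsingleton.elim _ _⟩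
  infer_instance

theorem IsLSA.mulRight_mul {K A : Type*} [Field K] [AddCommGroup A] [Module K A]
    {mul : A →ₗ[K] A →ₗ[K] A} (h : IsLSA mul) (x y : A) :
    mul.flip (mul x y) =
      mul.flip y * mul.flip x + (mul x * mul.flip y - mul.flip y * mul x) := by
  ext z
  have := h z x y
  simp
  linear_combination (norm := module) -this

/-- If the underlying Lie algebra is perfect, then right multiplications are nilpotent. -/
theorem IsLSA.isNilpotent_mulRight {K A : Type*} [Field K] [CharZero K] [AddCommGroup A]
    [Module K A] [FiniteDimensional K A] {mul : A →ₗ[K] A →ₗ[K] A} (h : IsLSA mul)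
    (hperf : Submodule.span K {z : A | ∃ x y : A, z = mul x y - mul y x} = ⊤) (a : A) :
    IsNilpotent (mul.flip a : Module.End K A) := by
  have vanish : ∀ T : A →ₗ[K] K, (∀ x y, T (mul x y - mul y x) = 0) → T = 0 := fun T hT =>
    LinearMap.ext_on_range (v := fun p : A × A => mul p.1 p.2 - mul p.2 p.1)
      (by rw [← hperf]; congr 1; ext z; simp [eq_comm]) fun p => hT p.1 p.2
  have hL : LinearMap.trace K A ∘ₗ mul = 0 := vanish _ fun x y => by
    have : mul (mul x y - mul y x) = mul x * mul y - mul y * mul x := by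
      ext z
      have := h x y z
      simp
      linear_combination (norm := module) this
    rw [LinearMap.comp_apply, this, map_sub, LinearMap.trace_mul_comm, sub_self]
  have hR : LinearMap.trace K A ∘ₗ mul.flip = 0 := vanish _ fun x y => by
    let ad := mul - mul.flip
    have had : ad (mul x y - mul y x) = ad x * ad y - ad y * ad x := by
      ext z
      have h₁ := h x y z
      have h₂ := h y z x
      have h₃ := h z x y
      simp [ad]
      linear_combination (norm := module) h₁ + h₂ + h₃
    have htr : LinearMap.trace K A (ad (mul x y - mul y x)) = 0 := by
      rw [had, map_sub, LinearMap.trace_mul_comm, sub_self]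
    have hz := LinearMap.congr_fun hL (mul x y - mul y x)
    rw [LinearMap.sub_apply, map_sub, sub_eq_zero] at htr
    exact htr.symm.trans hz
  have key : ∀ k j, LinearMap.trace K A (mul.flip a ^ j * mul.flip ((mul.flip a ^ k) a)) =
      LinearMap.trace K A (mul.flip a ^ (j + k + 1)) := by
    intro k
    induction k with
    | zero => intro j; simp [pow_succ]
    | succ k ih =>
      intro j
      rw [pow_succ' (mul.flip a) k, Module.End.mul_apply, LinearMap.flip_apply, h.mulRight_mul]
      have hcomm : LinearMap.trace K A (mul.flip a ^ j *
          (mul ((mul.flip a ^ k) a) * mul.flip a - mul.flip a * mul ((mul.flip a ^ k) a))) = 0 := by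
        rw [mul_sub, map_sub, ← mul_assoc, ← mul_assoc, ← pow_succ,
          LinearMap.trace_mul_comm, ← mul_assoc, ← pow_succ', sub_self]
      rw [mul_add, map_add, hcomm, add_zero, ← mul_assoc, ← pow_succ, ih (j + 1)]
      congr 2
      ring
  refine Module.End.isNilpotent_of_trace_pow_eq_zero _ fun k => ?_
  rw [← zero_add k, ← key k 0, pow_zero, one_mul]
  exact LinearMap.congr_fun hR _

/-- The underlying Lie algebra of a nonzero left-symmetric algebra is not perfect. -/
theorem IsLSA.span_commutator_ne_top {K A : Type*} [Field K] [CharZero K] [AddCommGroup A]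
    [Module K A] [FiniteDimensional K A] [Nontrivial A] {mul : A →ₗ[K] A →ₗ[K] A}
    (h : IsLSA mul) :
    Submodule.span K {z : A | ∃ x y : A, z = mul x y - mul y x} ≠ ⊤ := by
  intro hperf
  obtain ⟨k, hk⟩ := h.exists_derSeriesLSA_eq_bot fun a =>
    ((Module.End.isUnit_iff _).mp (h.isNilpotent_mulRight hperf a).isUnit_one_add).injective
  have htop : ∀ k, derSeriesLSA mul k = ⊤ := fun k => by
    induction k with
    | zero => rfl
    | succ k ih => simpa [derSeriesLSA, ih] using hperf
  exact top_ne_bot ((htop k).symm.trans hk)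

end

theorem stmt10 (𝔽 : Type*) [Field 𝔽] [CharZero 𝔽]
    (A : Type*) [AddCommGroup A] [Module 𝔽 A] [FiniteDimensional 𝔽 A]
    (mul : A →ₗ[𝔽] A →ₗ[𝔽] A) (hlsa : IsLSA mul) :
    -- (1) completeness implies solvability of the underlying Lie algebra
    ((∀ a : A, Function.Bijective (LinearMap.id + mul.flip a : A →ₗ[𝔽] A)) →
      ∃ k : ℕ, derSeriesLSA mul k = ⊥) ∧
    -- (2) if A ≠ 0 the underlying Lie algebra is not perfect
    ((∃ a : A, a ≠ 0) →
      Submodule.span 𝔽 {z : A | ∃ x y : A, z = mul x y - mul y x} ≠ ⊤) := by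
  refine ⟨fun hc => hlsa.exists_derSeriesLSA_eq_bot fun a => (hc a).injective, ?_⟩
  rintro ⟨a, ha⟩
  have : Nontrivial A := ⟨a, 0, ha⟩
  exact hlsa.span_commutator_ne_top
end
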